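/- arXiv:2203.06236 — 3 statements merged into one kernel-verified Lean document; each statement's English description precedes it below -/
import Mathlib

section
/- Let w be a nonnegative integer and f ∈ C^{w+1}(ℝ). Then there exists a constant C (depending only on f and w) such that for every positive integer N, | ∫_0^1 f(y) dy − (1/N)( (1/2)f(0) + f(1/N) + … + f((N−1)/N) + (1/2)f(1) ) − Σ_{j=1}^{⌊w/2⌋} N^{−2j} ( f^{(2j−1)}(0) − f^{(2j−1)}(1) ) B_{2j}(0) | ≤ C N^{−w−1}. -/
open scoped Real
open MeasureTheory

/-- The periodized Bernoulli polynomial `B_n`: the 1-periodic function that on `(0,1)`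
equals the classical Bernoulli polynomial of degree `n` divided by `n!`, regularized at
integer points by the average of the one-sided limits. -/
noncomputable def perB (n : ℕ) (x : ℝ) : ℝ :=
  if Int.fract x = 0 then
    ((Polynomial.aeval (0 : ℝ) (Polynomial.bernoulli n)) +
      (Polynomial.aeval (1 : ℝ) (Polynomial.bernoulli n))) / (2 * n.factorial)
  else (Polynomial.aeval (Int.fract x) (Polynomial.bernoulli n)) / n.factorial

/-- The sum over the `N` equal subintervals of `[0,1]` of the integrals of `g` against the
rescaled Bernoulli polynomial of degree `k` divided by `k!`. -/
noncomputable def bernoulliMoment (k N : ℕ) (g : ℝ → ℝ) : ℝ :=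
  ∑ i ∈ Finset.range N,
    ∫ t in (0 : ℝ)..1, bernoulliFun k t / k.factorial * g ((i + t) / N)

theorem perB_zero_right (n : ℕ) :
    perB n 0 = (bernoulliFun n 0 + bernoulliFun n 1) / (2 * n.factorial) := by
  simp [perB, bernoulliFun, Polynomial.eval_map_algebraMap]

theorem bernoulliFun_one_div_factorial (n : ℕ) :
    bernoulliFun n 1 / n.factorial = perB n 0 + if n = 1 then 1 / 2 else 0 := by
  rw [perB_zero_right, bernoulliFun_eval_one]
  have : (n.factorial : ℝ) ≠ 0 := by positivity
  split_ifs with h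
  · subst h; norm_num
  · field_simp; ring

theorem bernoulliFun_zero_div_factorial (n : ℕ) :
    bernoulliFun n 0 / n.factorial = perB n 0 - if n = 1 then 1 / 2 else 0 := by
  rw [perB_zero_right, bernoulliFun_eval_one]
  have : (n.factorial : ℝ) ≠ 0 := by positivity
  split_ifs with h
  · subst h; norm_num
  · field_simp; ring

theorem perB_zero_right_of_odd {n : ℕ} (hn : Odd n) : perB n 0 = 0 := by
  rcases eq_or_ne n 1 with rfl | h1
  · norm_num [perB_zero_right]
  · have : bernoulli n = 0 := bernoulli_eq_zero_of_odd hn (by have := hn.pos; omega)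
    rw [perB_zero_right, bernoulliFun_endpoints_eq_of_ne_one h1, bernoulliFun_eval_zero, this]
    simp

theorem hasDerivAt_bernoulliFun_div_factorial (k : ℕ) (x : ℝ) :
    HasDerivAt (fun t => bernoulliFun (k + 1) t / (k + 1).factorial)
      (bernoulliFun k x / k.factorial) x := by
  convert! (hasDerivAt_bernoulliFun (k + 1) x).div_const ((k + 1).factorial : ℝ) using 1
  have : (k.factorial : ℝ) ≠ 0 := by positivity
  rw [Nat.factorial_succ, Nat.add_sub_cancel]
  push_cast
  field_simp

theorem integral_bernoulliFun_mul_comp {g g' : ℝ → ℝ} (hg : ∀ x, HasDerivAt g (g' x) x)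
    (hg' : Continuous g') (k N i : ℕ) :
    ∫ t in (0 : ℝ)..1, bernoulliFun k t / k.factorial * g ((i + t) / N) =
      perB (k + 1) 0 * (g ((i + 1 : ℕ) / N) - g (i / N))
        + (if k = 0 then (g (i / N) + g ((i + 1 : ℕ) / N)) / 2 else 0)
        - 1 / N * ∫ t in (0 : ℝ)..1,
            bernoulliFun (k + 1) t / (k + 1).factorial * g' ((i + t) / N) := by
  have hu (x : ℝ) : HasDerivAt (fun t : ℝ => g ((i + t) / N)) (g' ((i + x) / N) * (1 / N)) x :=
    (hg _).comp x (((hasDerivAt_id x).const_add (i : ℝ)).div_const (N : ℝ))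
  have key := intervalIntegral.integral_mul_deriv_eq_deriv_mul (a := 0) (b := 1)
    (fun x _ => hu x) (fun x _ => hasDerivAt_bernoulliFun_div_factorial k x)
    (Continuous.intervalIntegrable (by fun_prop) _ _)
    (Continuous.intervalIntegrable (by fun_prop) _ _)
  have hint : ∫ t in (0 : ℝ)..1, g' ((i + t) / N) * (1 / N)
        * (bernoulliFun (k + 1) t / (k + 1).factorial) =
      1 / N * ∫ t in (0 : ℝ)..1,
        bernoulliFun (k + 1) t / (k + 1).factorial * g' ((i + t) / N) := by
    rw [← intervalIntegral.integral_const_mul]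
    congr 1 with t
    ring
  simp_rw [mul_comm (bernoulliFun k _ / _)]
  rw [key, hint, bernoulliFun_one_div_factorial, bernoulliFun_zero_div_factorial]
  simp only [Nat.add_eq_right, add_zero, Nat.cast_add, Nat.cast_one]
  split_ifs <;> ring

theorem sum_trapezoid (g : ℝ → ℝ) {N : ℕ} (hN : 0 < N) :
    ∑ i ∈ Finset.range N, (g (i / N) + g ((i + 1 : ℕ) / N)) / 2 =
      (g 0 + g 1) / 2 + ∑ k ∈ Finset.Ioo 0 N, g ((k : ℝ) / N) := by
  have hN' : (N : ℝ) ≠ 0 := by positivity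
  have htel := Finset.sum_range_sub (fun i : ℕ => g (i / N)) N
  have hleft : ∑ i ∈ Finset.range N, g ((i : ℝ) / N) =
      g 0 + ∑ k ∈ Finset.Ioo 0 N, g ((k : ℝ) / N) := by
    rw [← Nat.Ico_zero_eq_range, ← Finset.Ioo_insert_left hN, Finset.sum_insert (by simp)]
    simp
  rw [Finset.sum_sub_distrib, div_self hN', Nat.cast_zero, zero_div] at htel
  rw [← Finset.sum_div, Finset.sum_add_distrib]
  linarith

theorem bernoulliMoment_eq {g g' : ℝ → ℝ} (hg : ∀ x, HasDerivAt g (g' x) x)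
    (hg' : Continuous g') (k : ℕ) {N : ℕ} (hN : 0 < N) :
    bernoulliMoment k N g = perB (k + 1) 0 * (g 1 - g 0)
      + (if k = 0 then (g 0 + g 1) / 2 + ∑ i ∈ Finset.Ioo 0 N, g ((i : ℝ) / N) else 0)
      - 1 / N * bernoulliMoment (k + 1) N g' := by
  have hN' : (N : ℝ) ≠ 0 := by positivity
  have htel := Finset.sum_range_sub (fun i : ℕ => g (i / N)) N
  rw [div_self hN', Nat.cast_zero, zero_div] at htel
  simp only [bernoulliMoment, integral_bernoulliFun_mul_comp hg hg']
  rw [Finset.sum_sub_distrib, Finset.sum_add_distrib, ← Finset.mul_sum, ← Finset.mul_sum, htel]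
  split_ifs
  · rw [sum_trapezoid g hN]
  · simp

theorem integral_eq_bernoulliMoment_zero {g : ℝ → ℝ} (hg : Continuous g) {N : ℕ} (hN : 0 < N) :
    ∫ y in (0 : ℝ)..1, g y = 1 / N * bernoulliMoment 0 N g := by
  have hN' : (N : ℝ) ≠ 0 := by positivity
  have hsum := intervalIntegral.sum_integral_adjacent_intervals (f := g) (μ := volume)
    (a := fun i : ℕ => (i : ℝ) / N) (n := N) (fun i _ => hg.intervalIntegrable _ _)
  rw [div_self hN', Nat.cast_zero, zero_div] at hsum
  rw [← hsum, bernoulliMoment, Finset.mul_sum]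
  refine Finset.sum_congr rfl fun i _ => ?_
  have h := intervalIntegral.mul_integral_comp_add_mul (a := 0) (b := 1) (f := g)
    (c := (1 / N : ℝ)) (d := i / N)
  simp only [bernoulliFun_zero, Nat.factorial_zero, Nat.cast_one, div_one, one_mul]
  convert! h.symm using 2
  · simp
  · push_cast; ring
  · congr 1 with t
    congr 1
    ring

theorem abs_bernoulliMoment_le {g : ℝ → ℝ} (hg : Continuous g) (k : ℕ) :
    ∃ K : ℝ, ∀ N : ℕ, |bernoulliMoment k N g| ≤ N * K := by
  obtain ⟨A, hA⟩ := isCompact_Icc.exists_bound_of_continuousOn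
    (s := Set.Icc (0 : ℝ) 1) (f := fun t => bernoulliFun k t / k.factorial)
    (Continuous.continuousOn (by fun_prop))
  obtain ⟨G, hG⟩ := isCompact_Icc.exists_bound_of_continuousOn
    (s := Set.Icc (0 : ℝ) 1) hg.continuousOn
  refine ⟨A * G, fun N => ?_⟩
  have hterm : ∀ i ∈ Finset.range N,
      |∫ t in (0 : ℝ)..1, bernoulliFun k t / k.factorial * g ((i + t) / N)| ≤ A * G := by
    intro i hi
    have hiN : (i : ℝ) + 1 ≤ N := by exact_mod_cast Finset.mem_range.mp hi
    have hN : (0 : ℝ) < N := lt_of_lt_of_le (by positivity) hiN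
    have h := intervalIntegral.norm_integral_le_of_norm_le_const (a := 0) (b := 1) (C := A * G)
      (f := fun t : ℝ => bernoulliFun k t / k.factorial * g ((i + t) / N)) (fun t ht => by
        rw [Set.uIoc_of_le zero_le_one] at ht
        have ht' : (i + t) / N ∈ Set.Icc (0 : ℝ) 1 :=
          ⟨div_nonneg (add_nonneg i.cast_nonneg ht.1.le) hN.le,
            (div_le_one hN).mpr (by linarith [ht.2])⟩
        rw [norm_mul]
        have hA' := hA t ⟨ht.1.le, ht.2⟩
        exact mul_le_mul hA' (hG _ ht') (norm_nonneg _) ((norm_nonneg _).trans hA'))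
    simpa using h
  calc |bernoulliMoment k N g| ≤ ∑ i ∈ Finset.range N, A * G :=
        (Finset.abs_sum_le_sum_abs _ _).trans (Finset.sum_le_sum hterm)
    _ = N * (A * G) := by simp

theorem hasDerivAt_iteratedDeriv {f : ℝ → ℝ} {n m : ℕ} (hf : ContDiff ℝ n f) (hmn : m < n)
    (x : ℝ) : HasDerivAt (iteratedDeriv m f) (iteratedDeriv (m + 1) f x) x := by
  rw [iteratedDeriv_succ]
  exact (hf.differentiable_iteratedDeriv m (by exact_mod_cast hmn) x).hasDerivAt

/-- The Euler–Maclaurin formula for the composite trapezoidal rule on `[0,1]`, with remainder. -/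
theorem euler_maclaurin {f : ℝ → ℝ} {m : ℕ} (hf : ContDiff ℝ (m + 1 : ℕ) f) {N : ℕ}
    (hN : 0 < N) :
    (∫ y in (0 : ℝ)..1, f y)
        - (1 / (N : ℝ)) * ((f 0 + f 1) / 2 + ∑ k ∈ Finset.Ioo 0 N, f ((k : ℝ) / N))
        - ∑ j ∈ Finset.Icc 1 (m / 2), (N : ℝ) ^ (-(2 * j : ℤ))
            * (iteratedDeriv (2 * j - 1) f 0 - iteratedDeriv (2 * j - 1) f 1) * perB (2 * j) 0 =
      (-1) ^ m * (1 / (N : ℝ)) ^ (m + 1)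
        * (perB (m + 1) 0 * (iteratedDeriv m f 1 - iteratedDeriv m f 0)
          - 1 / N * bernoulliMoment (m + 1) N (iteratedDeriv (m + 1) f)) := by
  induction m with
  | zero =>
    rw [integral_eq_bernoulliMoment_zero hf.continuous hN]
    have h := bernoulliMoment_eq (hasDerivAt_iteratedDeriv hf zero_lt_one)
      (hf.continuous_iteratedDeriv 1 le_rfl) 0 hN
    simp only [iteratedDeriv_zero, zero_add, if_true] at h ⊢
    rw [h]
    simp
    ring
  | succ m ih =>
    have ih := ih (hf.of_le (by exact_mod_cast (m + 1).le_succ))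
    have h := bernoulliMoment_eq (hasDerivAt_iteratedDeriv hf (m + 1).lt_succ_self)
      (hf.continuous_iteratedDeriv (m + 2) le_rfl) (m + 1) hN
    rw [if_neg m.succ_ne_zero] at h
    rw [h] at ih
    rcases Nat.even_or_odd' m with ⟨c, rfl | rfl⟩
    · rw [show (2 * c + 1) / 2 = 2 * c / 2 by omega, ih,
        perB_zero_right_of_odd (odd_two_mul_add_one c)]
      ring
    · rw [show (2 * c + 1 + 1) / 2 = (2 * c + 1) / 2 + 1 by omega,
        Finset.sum_Icc_succ_top (by omega), ← sub_sub, ih,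
        show 2 * ((2 * c + 1) / 2 + 1) = 2 * c + 1 + 1 by omega]
      have hpow : (N : ℝ) ^ (-(2 * (((2 * c + 1) / 2 + 1 : ℕ) : ℤ))) =
          (1 / (N : ℝ)) ^ (2 * c + 1 + 1) := by
        rw [show 2 * (((2 * c + 1) / 2 + 1 : ℕ) : ℤ) = ((2 * c + 1 + 1 : ℕ) : ℤ) by omega,
          zpow_neg, zpow_natCast, one_div, inv_pow]
      rw [hpow, Nat.add_sub_cancel, pow_succ (-1 : ℝ) (2 * c + 1),
        (odd_two_mul_add_one c).neg_one_pow]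
      ring

theorem stmt3 (w : ℕ) (f : ℝ → ℝ) (hf : ContDiff ℝ (w + 1) f) :
    ∃ C : ℝ, ∀ N : ℕ, 0 < N →
      |(∫ y in (0 : ℝ)..1, f y)
          - (1 / (N : ℝ)) * ((f 0 + f 1) / 2 + ∑ k ∈ Finset.Ioo 0 N, f ((k : ℝ) / N))
          - ∑ j ∈ Finset.Icc 1 (w / 2),
              (N : ℝ) ^ (-(2 * j : ℤ))
                * (iteratedDeriv (2 * j - 1) f 0 - iteratedDeriv (2 * j - 1) f 1)
                * perB (2 * j) 0|
        ≤ C * (N : ℝ) ^ (-(w : ℤ) - 1) := by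
  have hf' : ContDiff ℝ (w + 1 : ℕ) f := by exact_mod_cast hf
  obtain ⟨K, hK⟩ := abs_bernoulliMoment_le (hf'.continuous_iteratedDeriv (w + 1) le_rfl) (w + 1)
  refine ⟨|perB (w + 1) 0 * (iteratedDeriv w f 1 - iteratedDeriv w f 0)| + K, fun N hN => ?_⟩
  have hN' : (0 : ℝ) < N := by exact_mod_cast hN
  have hpow : (N : ℝ) ^ (-(w : ℤ) - 1) = (1 / (N : ℝ)) ^ (w + 1) := by
    rw [show -(w : ℤ) - 1 = -((w + 1 : ℕ) : ℤ) by push_cast; ring, zpow_neg, zpow_natCast,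
      one_div, inv_pow]
  rw [euler_maclaurin hf' hN, hpow, abs_mul, abs_mul, abs_pow, abs_neg, abs_one, one_pow, one_mul,
    abs_of_pos (by positivity : (0 : ℝ) < (1 / (N : ℝ)) ^ (w + 1)), mul_comm]
  gcongr
  refine (abs_sub _ _).trans ?_
  gcongr
  rw [abs_mul, abs_of_pos (by positivity : (0 : ℝ) < 1 / N), one_div_mul_eq_div,
    div_le_iff₀' hN']
  exact hK N
end

section
/- For every integer n ≥ 0 one has (2π)^{−n} ≤ sup_{x∈[0,1]} |B_n(x)| ≤ (π²/3)(2π)^{−n}. -/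
open scoped Real

lemma aeval_bernoulli_eq_bernoulliFun (n : ℕ) (x : ℝ) :
    Polynomial.aeval x (Polynomial.bernoulli n) = bernoulliFun n x := by
  rw [bernoulliFun, Polynomial.eval_map_algebraMap]

/-- Away from the discontinuous case `n = 1`, `perB n` is `bernoulliFun n / n!` on `[0, 1]`. -/
lemma perB_eq_bernoulliFun_div {n : ℕ} (hn : n ≠ 1) {x : ℝ} (hx : x ∈ Set.Icc (0 : ℝ) 1) :
    perB n x = bernoulliFun n x / n.factorial := by
  have endpoints := bernoulliFun_endpoints_eq_of_ne_one hn
  have hf : (n.factorial : ℝ) ≠ 0 := Nat.cast_ne_zero.mpr n.factorial_ne_zero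
  simp only [perB, aeval_bernoulli_eq_bernoulliFun]
  rcases hx.2.eq_or_lt with rfl | hlt
  · rw [if_pos Int.fract_one, endpoints]
    field_simp
    ring
  · rw [Int.fract_eq_self.mpr ⟨hx.1, hlt⟩]
    split_ifs with h
    · rw [h, endpoints]
      field_simp
      ring
    · rfl

lemma norm_fourier_apply (k : ℤ) (x : UnitAddCircle) : ‖fourier k x‖ = 1 := by
  rw [fourier_apply]
  exact Circle.norm_coe _

lemma abs_bernoulliFun_div_factorial_le {n : ℕ} (hn : 2 ≤ n) {x : ℝ}
    (hx : x ∈ Set.Icc (0 : ℝ) 1) :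
    |bernoulliFun n x / n.factorial| ≤ π ^ 2 / 3 * ((2 * π) ^ n)⁻¹ := by
  have hsum := hasSum_one_div_nat_pow_mul_fourier hn hx
  have hzeta := hasSum_zeta_two.mul_left 2
  have hterm (m : ℕ) : ‖(1 : ℂ) / (m : ℂ) ^ n *
      (fourier m (x : UnitAddCircle) + (-1 : ℂ) ^ n * fourier (-m) (x : UnitAddCircle))‖ ≤
      2 * (1 / (m : ℝ) ^ 2) := by
    have hfourier : ‖fourier m (x : UnitAddCircle) +
        (-1 : ℂ) ^ n * fourier (-m) (x : UnitAddCircle)‖ ≤ 2 := by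
      refine (norm_add_le _ _).trans_eq ?_
      rw [norm_mul, norm_pow, norm_neg, norm_one, one_pow, norm_fourier_apply, norm_fourier_apply]
      norm_num
    have hpow : ‖(1 : ℂ) / (m : ℂ) ^ n‖ ≤ 1 / (m : ℝ) ^ 2 := by
      rw [norm_div, norm_one, norm_pow, Complex.norm_natCast]
      rcases m.eq_zero_or_pos with rfl | hm
      · simp [show n ≠ 0 by lia]
      · have : (1 : ℝ) ≤ m := mod_cast hm
        gcongr
    rw [norm_mul, mul_comm 2]
    gcongr
  have hle := tsum_of_norm_bounded hzeta hterm
  rw [hsum.tsum_eq] at hle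
  have hnorm : ‖-(2 * π * Complex.I) ^ n / n.factorial * bernoulliFun n x‖ =
      |bernoulliFun n x / n.factorial| * (2 * π) ^ n := by
    simp only [norm_mul, norm_div, norm_neg, norm_pow, Complex.norm_I, Complex.norm_real,
      Complex.norm_natCast, Complex.norm_ofNat, Real.norm_eq_abs, abs_div, Nat.abs_cast,
      abs_of_pos Real.pi_pos]
    ring
  rw [hnorm] at hle
  rw [← div_eq_mul_inv, le_div_iff₀ (by positivity)]
  linarith

lemma inv_two_pi_pow_le_of_abs_bernoulliFun_le {n : ℕ} (hn : n ≠ 0) {C : ℝ}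
    (hC : ∀ x ∈ Set.Icc (0 : ℝ) 1, |bernoulliFun n x / n.factorial| ≤ C) :
    ((2 * π) ^ n)⁻¹ ≤ C := by
  have hf : (0 : ℝ) < n.factorial := mod_cast n.factorial_pos
  have hcoeff := bernoulliFourierCoeff_eq hn 1
  rw [bernoulliFourierCoeff, fourierCoeffOn_eq_integral] at hcoeff
  have hnorm := congrArg norm hcoeff
  have hint : ‖∫ x in (0 : ℝ)..1, fourier (-1) (x : AddCircle ((1 : ℝ) - 0)) •
      (bernoulliFun n x : ℂ)‖ ≤ C * n.factorial * |(1 : ℝ) - 0| := by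
    refine intervalIntegral.norm_integral_le_of_norm_le_const fun x hx => ?_
    rw [Set.uIoc_of_le zero_le_one] at hx
    have hx' := hC x (Set.Ioc_subset_Icc_self hx)
    rw [abs_div, Nat.abs_cast, div_le_iff₀ hf] at hx'
    rw [fourier_apply, norm_smul, Circle.norm_coe, one_mul, Complex.norm_real]
    exact hx'
  rw [norm_smul] at hnorm
  simp only [norm_mul, norm_div, norm_neg, norm_pow, Complex.norm_I, Complex.norm_real,
    Complex.norm_natCast, Complex.norm_ofNat, Real.norm_eq_abs, Int.cast_one, norm_one,
    abs_of_pos Real.pi_pos, mul_one, sub_zero, abs_one, div_one, one_mul] at hnorm hint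
  rw [hnorm, div_eq_mul_inv, mul_comm] at hint
  exact le_of_mul_le_mul_right hint hf

lemma perB_one (x : ℝ) : perB 1 x = if Int.fract x = 0 then 0 else Int.fract x - 1 / 2 := by
  simp only [perB, aeval_bernoulli_eq_bernoulliFun, bernoulliFun_one]
  norm_num

lemma abs_perB_one_le (x : ℝ) : |perB 1 x| ≤ 1 / 2 := by
  rw [perB_one]
  split_ifs
  · norm_num
  · rw [abs_le]
    constructor <;> linarith [Int.fract_nonneg x, Int.fract_lt_one x]

lemma abs_perB_le (n : ℕ) {x : ℝ} (hx : x ∈ Set.Icc (0 : ℝ) 1) :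
    |perB n x| ≤ π ^ 2 / 3 * ((2 * π) ^ n)⁻¹ := by
  have hpi := Real.pi_gt_three
  obtain rfl | rfl | hn : n = 0 ∨ n = 1 ∨ 2 ≤ n := by lia
  · rw [perB_eq_bernoulliFun_div zero_ne_one hx]
    norm_num
    nlinarith
  · refine (abs_perB_one_le x).trans ?_
    rw [show π ^ 2 / 3 * ((2 * π) ^ 1)⁻¹ = π / 6 by field_simp; norm_num]
    linarith
  · rw [perB_eq_bernoulliFun_div (by lia) hx]
    exact abs_bernoulliFun_div_factorial_le hn hx

lemma inv_two_pi_pow_le_of_abs_perB_le (n : ℕ) {C : ℝ}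
    (hC : ∀ x ∈ Set.Icc (0 : ℝ) 1, |perB n x| ≤ C) : ((2 * π) ^ n)⁻¹ ≤ C := by
  obtain rfl | rfl | hn : n = 0 ∨ n = 1 ∨ 2 ≤ n := by lia
  · have h := hC 0 (by simp)
    rw [perB_eq_bernoulliFun_div zero_ne_one (by simp)] at h
    simpa using h
  · have h := hC (1 / 4) (by norm_num)
    rw [perB_one, Int.fract_eq_self.mpr (by norm_num)] at h
    norm_num at h
    refine le_trans ?_ h
    rw [pow_one, one_div]
    exact inv_anti₀ (by norm_num) (by linarith [Real.pi_gt_three])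
  · refine inv_two_pi_pow_le_of_abs_bernoulliFun_le (n := n) (by lia) fun x hx => ?_
    rw [← perB_eq_bernoulliFun_div (by lia) hx]
    exact hC x hx

theorem stmt5 (n : ℕ) :
    (2 * π) ^ (-(n : ℤ)) ≤ (⨆ x : Set.Icc (0 : ℝ) 1, |perB n x|) ∧
    (⨆ x : Set.Icc (0 : ℝ) 1, |perB n x|) ≤ (π ^ 2 / 3) * (2 * π) ^ (-(n : ℤ)) := by
  rw [zpow_neg, zpow_natCast]
  have hbdd : BddAbove (Set.range fun x : Set.Icc (0 : ℝ) 1 => |perB n x|) :=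
    ⟨_, Set.forall_mem_range.mpr fun x => abs_perB_le n x.2⟩
  exact ⟨inv_two_pi_pow_le_of_abs_perB_le n fun x hx => le_ciSup hbdd ⟨x, hx⟩,
    ciSup_le fun x => abs_perB_le n x.2⟩
end

section
/- Let J = (j_1,…,j_d) be a multi-index of nonnegative integers, let L ∈ GL(d,ℤ), and let I = (i_1,…,i_d) be defined by i_k = 0 if j_k = 0 and i_k = 1 if j_k > 0. Set Δ(I,L) = { n ∈ ℤ^d : (Ln)_k = 0 if and only if i_k = 0 }. Then for every x ∈ ℝ^d, 𝔅_{J,L}(x) = lim_{ε→0+} (−1)^{|I|} Σ_{n∈Δ(I,L)} φ̂(εn) e^{2πin·x} / (2πiLn)^J, where (2πiLn)^J = Π_{k=1}^d (2πi(Ln)_k)^{j_k} with the convention 0^0 = 1 (so all denominators are nonzero on Δ(I,L)). -/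
open scoped Real Topology
open MeasureTheory Filter

/-- The Euclidean unit ball `{ y : |y| ≤ 1 }` in `ℝ^d`. -/
def eball (d : ℕ) : Set (Fin d → ℝ) := {y | ∑ i, (y i) ^ 2 ≤ 1}

/-- The multivariate Bernoulli polynomial `B_J`, supported on `[0,1)^d`. -/
noncomputable def BJ (d : ℕ) (J : Fin d → ℕ) (x : Fin d → ℝ) : ℝ :=
  if ∀ k, x k ∈ Set.Ico (0 : ℝ) 1 then ∏ k, perB (J k) (x k) else 0

/-- `B_{J,L}(x) = |det L|⁻¹ B_J((L⁻¹)^t x)`. -/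
noncomputable def BJL (d : ℕ) (J : Fin d → ℕ) (L : Matrix (Fin d) (Fin d) ℝ)
    (x : Fin d → ℝ) : ℝ :=
  |L.det|⁻¹ * BJ d J (L⁻¹.transpose.mulVec x)

/-- The periodization `Σ_{n∈ℤ^d} B_{J,L}(x+n)`. -/
noncomputable def periB (d : ℕ) (J : Fin d → ℕ) (L : Matrix (Fin d) (Fin d) ℝ)
    (x : Fin d → ℝ) : ℝ :=
  ∑' n : Fin d → ℤ, BJL d J L (x + fun i => (n i : ℝ))

/-- The periodized multivariate Bernoulli polynomial `𝔅_{J,L}`, regularized (at its points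
of discontinuity) by the limit of its averages over small balls. -/
noncomputable def frakB (d : ℕ) (J : Fin d → ℕ) (L : Matrix (Fin d) (Fin d) ℝ)
    (x : Fin d → ℝ) : ℝ :=
  limUnder (𝓝[>] (0 : ℝ))
    (fun ε : ℝ => (volume (eball d)).toReal⁻¹ * ∫ y in eball d, periB d J L (x - ε • y))

/-- The Fourier transform `f̂(ξ) = ∫ f(v) e^{-2πi ξ·v} dv` on `ℝ^d`. -/
noncomputable def ft (d : ℕ) (f : (Fin d → ℝ) → ℂ) (ξ : Fin d → ℝ) : ℂ :=
  ∫ v, f v * Complex.exp (-2 * π * Complex.I * (∑ i, ξ i * v i))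

theorem perB_of_fract_ne_zero {t : ℝ} (j : ℕ) (ht : Int.fract t ≠ 0) :
    perB j t = bernoulliFun j (Int.fract t) / j.factorial := by
  rw [perB, if_neg ht, bernoulliFun]
  simp [Polynomial.aeval_def, Polynomial.eval_map]

theorem perB_periodic (j : ℕ) : Function.Periodic (perB j) 1 := by
  intro t
  simp only [perB, Int.fract_add_one]

theorem perB_add_intCast (j : ℕ) (t : ℝ) (n : ℤ) : perB j (t + n) = perB j t := by
  simp only [perB, Int.fract_add_intCast]

theorem perB_eq_of_mem_Ioo (j : ℕ) (n : ℤ) {t : ℝ} (ht : t ∈ Set.Ioo (n : ℝ) (n + 1)) :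
    perB j t = bernoulliFun j (t - n) / j.factorial := by
  have hfl : ⌊t⌋ = n := Int.floor_eq_iff.2 ⟨ht.1.le, ht.2⟩
  have hfr : Int.fract t = t - n := by rw [Int.fract, hfl]
  rw [perB_of_fract_ne_zero, hfr]
  rw [hfr]
  exact sub_ne_zero.2 ht.1.ne'

theorem continuous_bernoulliFun_sub_div (j : ℕ) (n : ℤ) :
    Continuous fun t : ℝ => bernoulliFun j (t - n) / j.factorial := by
  have := continuous_bernoulliFun (k := j)
  fun_prop

theorem continuousAt_perB (j : ℕ) {t : ℝ} (ht : Int.fract t ≠ 0) : ContinuousAt (perB j) t := by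
  have hlt : (⌊t⌋ : ℝ) < t :=
    lt_of_le_of_ne (Int.floor_le t) fun h => ht (by rw [Int.fract]; linarith)
  refine (continuous_bernoulliFun_sub_div j ⌊t⌋).continuousAt.congr ?_
  filter_upwards [Ioo_mem_nhds hlt (Int.lt_floor_add_one t)] with s hs
  exact (perB_eq_of_mem_Ioo j _ hs).symm

theorem exists_tendsto_perB_nhdsGT (j : ℕ) (t : ℝ) : ∃ l, Tendsto (perB j) (𝓝[>] t) (𝓝 l) := by
  refine ⟨_, ((continuous_bernoulliFun_sub_div j ⌊t⌋).tendsto t).mono_left nhdsWithin_le_nhds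
    |>.congr' ?_⟩
  filter_upwards [Ioo_mem_nhdsGT (Int.lt_floor_add_one t)] with s hs
  exact (perB_eq_of_mem_Ioo j _ ⟨(Int.floor_le t).trans_lt hs.1, hs.2⟩).symm

theorem exists_tendsto_perB_nhdsLT (j : ℕ) (t : ℝ) : ∃ l, Tendsto (perB j) (𝓝[<] t) (𝓝 l) := by
  refine ⟨_, ((continuous_bernoulliFun_sub_div j (⌈t⌉ - 1)).tendsto t).mono_left nhdsWithin_le_nhds
    |>.congr' ?_⟩
  have hlt : ((⌈t⌉ - 1 : ℤ) : ℝ) < t := by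
    push_cast
    linarith [Int.ceil_lt_add_one t]
  filter_upwards [Ioo_mem_nhdsLT hlt] with s hs
  refine (perB_eq_of_mem_Ioo j _ ⟨hs.1, ?_⟩).symm
  push_cast
  linarith [Int.le_ceil t, hs.2]

theorem exists_tendsto_perB_ray (j : ℕ) (t w : ℝ) :
    ∃ l, Tendsto (fun ε : ℝ => perB j (t - ε * w)) (𝓝[>] 0) (𝓝 l) := by
  have hcont : Tendsto (fun ε : ℝ => t - ε * w) (𝓝[>] 0) (𝓝 t) := by
    have : Continuous fun ε : ℝ => t - ε * w := by fun_prop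
    simpa using (this.tendsto 0).mono_left nhdsWithin_le_nhds
  rcases lt_trichotomy w 0 with hw | rfl | hw
  · obtain ⟨l, hl⟩ := exists_tendsto_perB_nhdsGT j t
    refine ⟨l, hl.comp (tendsto_nhdsWithin_iff.2 ⟨hcont, ?_⟩)⟩
    filter_upwards [self_mem_nhdsWithin] with ε hε
    have := mul_neg_of_pos_of_neg (Set.mem_Ioi.1 hε) hw
    exact Set.mem_Ioi.2 (by linarith)
  · exact ⟨perB j t, by simp⟩
  · obtain ⟨l, hl⟩ := exists_tendsto_perB_nhdsLT j t
    refine ⟨l, hl.comp (tendsto_nhdsWithin_iff.2 ⟨hcont, ?_⟩)⟩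
    filter_upwards [self_mem_nhdsWithin] with ε hε
    simpa using mul_pos hε hw

theorem measurable_perB (j : ℕ) : Measurable (perB j) := by
  have h : Continuous fun t : ℝ => Polynomial.aeval t (Polynomial.bernoulli j) :=
    Polynomial.continuous_aeval _
  exact Measurable.ite (measurable_fract (measurableSet_singleton 0)) measurable_const
    ((h.measurable.comp measurable_fract).div_const _)

theorem exists_abs_perB_le (j : ℕ) : ∃ C, 0 ≤ C ∧ ∀ t, |perB j t| ≤ C := by
  have hcont : Continuous fun t : ℝ => bernoulliFun j (t - (0 : ℤ)) / j.factorial :=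
    continuous_bernoulliFun_sub_div j 0
  obtain ⟨C, hC⟩ := isCompact_Icc.exists_bound_of_continuousOn (s := Set.Icc (0 : ℝ) 1)
    hcont.continuousOn
  refine ⟨max C |perB j 0|, (abs_nonneg _).trans (le_max_right _ _), fun t => ?_⟩
  by_cases ht : Int.fract t = 0
  · exact le_max_of_le_right (by simp [perB, ht])
  · rw [perB_of_fract_ne_zero j ht]
    refine le_max_of_le_left ?_
    simpa [abs_div] using hC (Int.fract t) ⟨Int.fract_nonneg t, (Int.fract_lt_one t).le⟩

theorem integral_exp_mul_perB (j : ℕ) (m : ℤ) :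
    ∫ t in (0 : ℝ)..1, Complex.exp (-(2 * π * Complex.I * (m * t))) * (perB j t : ℂ) =
      if j = 0 then (if m = 0 then 1 else 0) else -(1 / (2 * π * Complex.I * m) ^ j) := by
  have h1 : ∫ t in (0 : ℝ)..1, Complex.exp (-(2 * π * Complex.I * (m * t))) * (perB j t : ℂ) =
      (j.factorial : ℂ)⁻¹ * bernoulliFourierCoeff j m := by
    rw [bernoulliFourierCoeff, fourierCoeffOn_eq_integral, sub_zero, div_one, one_smul,
      ← intervalIntegral.integral_const_mul]
    refine intervalIntegral.integral_congr_Ioo_of_le zero_le_one fun t ht => ?_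
    have ht' : t ∈ Set.Ioo ((0 : ℤ) : ℝ) ((0 : ℤ) + 1) := by simpa using ht
    simp only [perB_eq_of_mem_Ioo j 0 ht', fourier_coe_apply, smul_eq_mul]
    push_cast
    simp only [sub_zero, div_one, mul_neg, neg_mul]
    ring_nf
  rw [h1]
  split_ifs with hj hm
  · subst hj hm
    simp [bernoulliFourierCoeff, fourierCoeffOn_eq_integral]
  · subst hj
    rw [bernoulli_zero_fourier_coeff hm, mul_zero]
  · rw [bernoulliFourierCoeff_eq hj]
    have : (j.factorial : ℂ) ≠ 0 := by exact_mod_cast j.factorial_ne_zero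
    field_simp

theorem tsum_BJ_add_intCast {d : ℕ} (J : Fin d → ℕ) (y : Fin d → ℝ) :
    ∑' n : Fin d → ℤ, BJ d J (y + fun i => (n i : ℝ)) = ∏ k, perB (J k) (y k) := by
  rw [tsum_eq_single fun k => -⌊y k⌋]
  · rw [BJ, if_pos]
    · exact Finset.prod_congr rfl fun k _ => perB_add_intCast _ _ _
    · intro k
      have h1 := Int.floor_le (y k)
      have h2 := Int.lt_floor_add_one (y k)
      constructor <;> simp <;> linarith
  · intro n hn
    rw [BJ, if_neg]
    contrapose! hn
    funext k
    have : ⌊y k⌋ = -n k := by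
      rw [Int.floor_eq_iff]
      obtain ⟨h1, h2⟩ := hn k
      simp only [Pi.add_apply] at h1 h2
      push_cast
      constructor <;> linarith
    omega

theorem map_intCast_inv_transpose {d : ℕ} {L : Matrix (Fin d) (Fin d) ℤ} (hL : IsUnit L.det) :
    (L.map (Int.cast : ℤ → ℝ))⁻¹.transpose = (L⁻¹.transpose).map (Int.cast : ℤ → ℝ) := by
  rw [Matrix.inv_eq_left_inv (B := L⁻¹.map (Int.cast : ℤ → ℝ)), Matrix.transpose_map]
  have h := congrArg (fun A => A.map (Int.castRingHom ℝ)) (Matrix.nonsing_inv_mul L hL)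
  rw [Matrix.map_mul] at h
  simpa using h

theorem map_intCast_mulVec {d : ℕ} (A : Matrix (Fin d) (Fin d) ℤ) (n : Fin d → ℤ) :
    (A.map (Int.cast : ℤ → ℝ)).mulVec (fun i => (n i : ℝ)) = fun i => ((A.mulVec n i : ℤ) : ℝ) := by
  funext i
  simp [Matrix.mulVec, dotProduct]

/-- The action of a unimodular integer matrix on integer vectors, as a permutation. -/
noncomputable def unimodularEquiv {d : ℕ} (A : Matrix (Fin d) (Fin d) ℤ) (hA : IsUnit A.det) :
    (Fin d → ℤ) ≃ (Fin d → ℤ) where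
  toFun n := A.mulVec n
  invFun n := A⁻¹.mulVec n
  left_inv n := by
    dsimp only
    rw [Matrix.mulVec_mulVec, Matrix.nonsing_inv_mul A hA, Matrix.one_mulVec]
  right_inv n := by
    dsimp only
    rw [Matrix.mulVec_mulVec, Matrix.mul_nonsing_inv A hA, Matrix.one_mulVec]

theorem unimodularEquiv_apply {d : ℕ} (A : Matrix (Fin d) (Fin d) ℤ) (hA : IsUnit A.det)
    (n : Fin d → ℤ) : unimodularEquiv A hA n = A.mulVec n := rfl

theorem periB_eq_prod {d : ℕ} (J : Fin d → ℕ) {L : Matrix (Fin d) (Fin d) ℤ} (hL : IsUnit L.det)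
    (x : Fin d → ℝ) :
    periB d J (L.map (Int.cast : ℤ → ℝ)) x =
      ∏ k, perB (J k) (((L⁻¹.transpose).map (Int.cast : ℤ → ℝ)).mulVec x k) := by
  have hdet : |(L.map (Int.cast : ℤ → ℝ)).det| = 1 := by
    have h := Int.cast_det (R := ℝ) L
    rw [← h]
    exact_mod_cast Int.isUnit_iff_abs_eq.1 hL
  have hT : IsUnit L⁻¹.transpose.det := by
    rw [Matrix.det_transpose]
    exact Matrix.isUnit_nonsing_inv_det L hL
  rw [periB, ← tsum_BJ_add_intCast,
    ← (unimodularEquiv _ hT).tsum_eq fun n => BJ d J (_ + fun i => (n i : ℝ))]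
  refine tsum_congr fun n => ?_
  rw [BJL, hdet, inv_one, one_mul, map_intCast_inv_transpose hL, Matrix.mulVec_add,
    map_intCast_mulVec, unimodularEquiv_apply]

theorem integral_exp_mul_perB_sub (j : ℕ) (m : ℤ) (w : ℝ) :
    ∫ t in (0 : ℝ)..1, Complex.exp (-(2 * π * Complex.I * (m * t))) * (perB j (t - w) : ℂ) =
      Complex.exp (-(2 * π * Complex.I * (m * w))) *
        ∫ t in (0 : ℝ)..1, Complex.exp (-(2 * π * Complex.I * (m * t))) * (perB j t : ℂ) := by
  have hper : Function.Periodic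
      (fun t : ℝ => Complex.exp (-(2 * π * Complex.I * (m * t))) * (perB j t : ℂ)) 1 := by
    intro t
    simp only [perB_periodic j t]
    congr 1
    rw [Complex.exp_eq_exp_iff_exists_int]
    refine ⟨-m, ?_⟩
    push_cast
    ring
  have hshift := hper.intervalIntegral_add_eq (0 - w) 0
  rw [zero_add, show (0 : ℝ) - w + 1 = 1 - w by ring,
    ← intervalIntegral.integral_comp_sub_right] at hshift
  rw [← hshift, ← intervalIntegral.integral_const_mul]
  refine intervalIntegral.integral_congr fun t _ => ?_
  rw [← mul_assoc (Complex.exp _) (Complex.exp _), ← Complex.exp_add]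
  congr 2
  push_cast
  ring

theorem integral_radial_mul_homogeneous {E : Type*} [NormedAddCommGroup E] [NormedSpace ℝ E]
    [FiniteDimensional ℝ E] [Nontrivial E] [MeasurableSpace E] [BorelSpace E] (μ : Measure E)
    [μ.IsAddHaarMeasure] (g : ℝ → ℝ) {h : E → ℝ} (hh : ∀ (c : ℝ) (v : E), 0 < c → h (c • v) = h v) :
    ∫ x, h x * g ‖x‖ ∂μ = (∫ s, h (s : E) ∂μ.toSphere) *
      ∫ r : Set.Ioi (0 : ℝ), g r ∂(Measure.volumeIoiPow (Module.finrank ℝ E - 1)) := by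
  calc
    ∫ x, h x * g ‖x‖ ∂μ = ∫ x : ({(0)}ᶜ : Set E), h x.1 * g ‖x.1‖ ∂(μ.comap (↑)) := by
      rw [integral_subtype_comap (measurableSet_singleton _).compl fun x ↦ h x * g ‖x‖,
        restrict_compl_singleton]
    _ = ∫ x, h x.1.1 * g x.2 ∂μ.toSphere.prod (.volumeIoiPow (Module.finrank ℝ E - 1)) := by
      rw [← μ.measurePreserving_homeomorphUnitSphereProd.integral_comp
        (Homeomorph.measurableEmbedding _)]
      refine integral_congr_ae (ae_of_all _ fun x => ?_)
      have hx : 0 < ‖x.1‖ := norm_pos_iff.2 x.2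
      simp [hh _ _ (inv_pos.2 hx)]
    _ = _ := integral_prod_mul (fun s : Metric.sphere (0 : E) 1 => h s)
      (fun r : Set.Ioi (0 : ℝ) => g r)

theorem measurableSet_euclideanUnitBall (d : ℕ) : MeasurableSet (eball d) :=
  (isClosed_le (by fun_prop) continuous_const).measurableSet

theorem volume_eball_ne_zero (d : ℕ) : volume (eball d) ≠ 0 := by
  have hopen : IsOpen {y : Fin d → ℝ | ∑ i, (y i) ^ 2 < 1} :=
    isOpen_lt (by fun_prop) continuous_const
  exact ne_of_gt <| (hopen.measure_pos volume ⟨0, by simp⟩).trans_le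
    (measure_mono fun y (hy : ∑ i, (y i) ^ 2 < 1) => show ∑ i, (y i) ^ 2 ≤ 1 from hy.le)

theorem volume_eball_ne_top (d : ℕ) : volume (eball d) ≠ ⊤ := by
  have hsub : eball d ⊆ Set.Icc (fun _ => -1) (fun _ => 1) := by
    intro y hy
    have h : ∀ i, |y i| ≤ 1 := fun i => by
      rw [← sq_le_one_iff_abs_le_one]
      exact (Finset.single_le_sum (f := fun i => y i ^ 2) (fun i _ => sq_nonneg _)
        (Finset.mem_univ i)).trans hy
    exact ⟨fun i => (abs_le.1 (h i)).1, fun i => (abs_le.1 (h i)).2⟩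
  exact ((measure_mono hsub).trans_lt isCompact_Icc.measure_lt_top).ne

/-- A probability density which is a function of the Euclidean norm gives a function homogeneous of
degree zero the same mean as the uniform distribution on the Euclidean unit ball. -/
theorem integral_radial_mul_eq_average {d : ℕ} (hd : 1 ≤ d) {φ : (Fin d → ℝ) → ℝ}
    (hφ_radial : ∀ x y : Fin d → ℝ, ∑ i, (x i) ^ 2 = ∑ i, (y i) ^ 2 → φ x = φ y)
    (hφ_int : ∫ x, φ x = 1) {h : (Fin d → ℝ) → ℝ}
    (hh : ∀ (c : ℝ) (v : Fin d → ℝ), 0 < c → h (c • v) = h v) :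
    ∫ v, φ v * h v = (volume (eball d)).toReal⁻¹ * ∫ y in eball d, h y := by
  have : NeZero d := ⟨by omega⟩
  let E := EuclideanSpace ℝ (Fin d)
  have : Nontrivial E := inferInstance
  let I : (ℝ → ℝ) → ℝ := fun g =>
    ∫ r : Set.Ioi (0 : ℝ), g r ∂(Measure.volumeIoiPow (Module.finrank ℝ E - 1))
  let S : ((Fin d → ℝ) → ℝ) → ℝ := fun f =>
    ∫ s, f (WithLp.ofLp (s : E)) ∂(volume : Measure E).toSphere
  have key : ∀ (f : (Fin d → ℝ) → ℝ) (g : ℝ → ℝ),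
      (∀ (c : ℝ) (v : Fin d → ℝ), 0 < c → f (c • v) = f v) →
      ∫ v, f v * g (√(∑ i, v i ^ 2)) = S f * I g := by
    intro f g hf
    rw [← (PiLp.volume_preserving_ofLp (Fin d)).integral_comp
      (MeasurableEquiv.toLp 2 (Fin d → ℝ)).symm.measurableEmbedding]
    rw [← integral_radial_mul_homogeneous (volume : Measure E) g
      (h := fun v => f (WithLp.ofLp v)) (fun c v hc => hf c (WithLp.ofLp v) hc)]
    simp [EuclideanSpace.norm_eq, E]
  let g₁ : ℝ → ℝ := fun r => φ (r • Pi.single 0 1)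
  have hg₁ : ∀ v, φ v = g₁ (√(∑ i, v i ^ 2)) := by
    intro v
    refine hφ_radial _ _ ?_
    have h0 : 0 ≤ ∑ i, v i ^ 2 := Finset.sum_nonneg fun i _ => sq_nonneg _
    simp [Pi.single_apply, Real.sq_sqrt h0]
  let g₂ : ℝ → ℝ := (Set.Iic 1).indicator 1
  have hg₂ : ∀ f : (Fin d → ℝ) → ℝ,
      ∫ y in eball d, f y = ∫ y, f y * g₂ (√(∑ i, y i ^ 2)) := by
    intro f
    rw [← integral_indicator (measurableSet_euclideanUnitBall d)]
    refine integral_congr_ae (ae_of_all _ fun y => ?_)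
    by_cases hy : ∑ i, y i ^ 2 ≤ 1
    · simp [eball, hy, g₂]
    · simp [eball, hy, g₂]
  have e1 : ∫ v, φ v * h v = S h * I g₁ := by
    rw [← key h g₁ hh]
    simp only [← hg₁, mul_comm]
  have e2 : S (fun _ => 1) * I g₁ = 1 := by
    rw [← key (fun _ => 1) g₁ (fun _ _ _ => rfl)]
    simpa only [← hg₁, one_mul] using hφ_int
  have e3 : ∫ y in eball d, h y = S h * I g₂ := by rw [hg₂, key h g₂ hh]
  have e4 : (volume (eball d)).toReal = S (fun _ => 1) * I g₂ := by
    rw [← key (fun _ => 1) g₂ (fun _ _ _ => rfl), ← hg₂]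
    simp [Measure.real]
  have h0 : (volume (eball d)).toReal ≠ 0 :=
    ENNReal.toReal_ne_zero.2 ⟨volume_eball_ne_zero d, volume_eball_ne_top d⟩
  rw [e1, e3, eq_inv_mul_iff_mul_eq₀ h0, e4]
  linear_combination (S h * I g₂) * e2

theorem tendsto_radial_average {d : ℕ} (hd : 1 ≤ d) {φ : (Fin d → ℝ) → ℝ}
    (hφ_radial : ∀ x y : Fin d → ℝ, ∑ i, (x i) ^ 2 = ∑ i, (y i) ^ 2 → φ x = φ y)
    (hφ_integrable : Integrable φ) (hφ_int : ∫ x, φ x = 1) {F : (Fin d → ℝ) → ℝ}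
    (hF : Measurable F) {C : ℝ} (hC : ∀ v, |F v| ≤ C)
    (hray : ∀ v, ∃ l, Tendsto (fun ε : ℝ => F (ε • v)) (𝓝[>] 0) (𝓝 l)) :
    ∃ l, Tendsto (fun ε : ℝ => (volume (eball d)).toReal⁻¹ * ∫ y in eball d, F (ε • y))
        (𝓝[>] 0) (𝓝 l) ∧
      Tendsto (fun ε : ℝ => ∫ v, φ v * F (ε • v)) (𝓝[>] 0) (𝓝 l) := by
  choose h hh using hray
  have hhom : ∀ (c : ℝ) (v : Fin d → ℝ), 0 < c → h (c • v) = h v := by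
    intro c v hc
    refine tendsto_nhds_unique (hh (c • v)) ?_
    have hmul : Tendsto (fun ε : ℝ => ε * c) (𝓝[>] 0) (𝓝[>] 0) := by
      refine tendsto_nhdsWithin_iff.2 ⟨?_, ?_⟩
      · simpa using ((continuous_mul_const c).tendsto (0 : ℝ)).mono_left nhdsWithin_le_nhds
      · filter_upwards [self_mem_nhdsWithin] with ε hε
        exact mul_pos hε hc
    simpa only [Function.comp_def, mul_smul] using (hh v).comp hmul
  have : IsFiniteMeasure (volume.restrict (eball d)) :=
    ⟨by simpa using (volume_eball_ne_top d).lt_top⟩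
  have hmeas : ∀ ε : ℝ, Measurable fun v : Fin d → ℝ => F (ε • v) := fun ε =>
    hF.comp (measurable_const_smul ε)
  refine ⟨(volume (eball d)).toReal⁻¹ * ∫ y in eball d, h y, ?_, ?_⟩
  rotate_left
  · rw [← integral_radial_mul_eq_average hd hφ_radial hφ_int hhom]
    refine tendsto_integral_filter_of_dominated_convergence (fun v => |φ v| * C) ?_ ?_ ?_ ?_
    · exact .of_forall fun ε => hφ_integrable.aestronglyMeasurable.mul
        (hmeas ε).aestronglyMeasurable
    · refine .of_forall fun ε => ae_of_all _ fun v => ?_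
      rw [Real.norm_eq_abs, abs_mul]
      exact mul_le_mul_of_nonneg_left (hC _) (abs_nonneg _)
    · exact hφ_integrable.abs.mul_const C
    · exact ae_of_all _ fun v => (hh v).const_mul _
  · refine Tendsto.const_mul _ ?_
    refine tendsto_integral_filter_of_dominated_convergence (fun v => C) ?_ ?_ ?_ ?_
    · exact .of_forall fun ε => (hmeas ε).aestronglyMeasurable
    · exact .of_forall fun ε => ae_of_all _ fun v => hC _
    · exact integrable_const C
    · exact ae_of_all _ fun v => hh v

theorem summable_norm_intCast_inv_pow (d : ℕ) {r : ℕ} (hr : d < r) :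
    Summable fun n : Fin d → ℤ => ‖fun i => (n i : ℝ)‖⁻¹ ^ r := by
  let b := Pi.basisFun ℝ (Fin d)
  let Λ := Submodule.span ℤ (Set.range b)
  let e : Λ ≃ₗ[ℤ] (Fin d → ℤ) := (b.restrictScalars ℤ).equivFun
  have hrank : Module.finrank ℤ Λ = d := by
    rw [Module.finrank_eq_card_basis (b.restrictScalars ℤ), Fintype.card_fin]
  have hs := ZLattice.summable_norm_pow_inv Λ r (by rwa [hrank])
  rw [← e.symm.toEquiv.summable_iff] at hs
  refine hs.congr fun n => ?_
  have : ((e.symm n : Λ) : Fin d → ℝ) = fun i => (n i : ℝ) := by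
    funext i
    have hb : ∀ k, ((b.restrictScalars ℤ k : Λ) : Fin d → ℝ) = Pi.single k 1 := fun k => by
      rw [← Pi.basisFun_apply]
      exact Module.Basis.restrictScalars_apply ℤ b k
    simp only [e, Module.Basis.equivFun_symm_apply, Submodule.coe_sum, Submodule.coe_smul, hb,
      Finset.sum_apply]
    simp [Pi.single_apply]
  change ‖((e.symm n : Λ) : Fin d → ℝ)‖⁻¹ ^ r = _
  rw [this]

theorem exists_norm_pow_mul_norm_ft_le {d : ℕ} {φ : (Fin d → ℝ) → ℝ}
    (hφ_smooth : ContDiff ℝ (⊤ : ℕ∞) φ) (hφ_supp : HasCompactSupport φ) (r : ℕ) :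
    ∃ C, ∀ ξ : Fin d → ℝ, ‖ξ‖ ^ r * ‖ft d (fun v => (φ v : ℂ)) ξ‖ ≤ C := by
  let f : EuclideanSpace ℝ (Fin d) → ℂ := fun v => (φ (WithLp.ofLp v) : ℂ)
  have hf : ContDiff ℝ (⊤ : ℕ∞) f :=
    Complex.ofRealCLM.contDiff.comp (hφ_smooth.comp (PiLp.contDiff_ofLp))
  have hfs : HasCompactSupport f :=
    (hφ_supp.comp_homeomorph (PiLp.homeomorph 2 fun _ : Fin d => ℝ)).comp_left
      (g := Complex.ofReal) Complex.ofReal_zero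
  obtain ⟨C, -, hC⟩ := (FourierTransform.fourier (hfs.toSchwartzMap hf)).decay r 0
  refine ⟨C, fun ξ => le_trans ?_ (hC (WithLp.toLp 2 ξ))⟩
  have hval : (FourierTransform.fourier (hfs.toSchwartzMap hf)) (WithLp.toLp 2 ξ) =
      ft d (fun v => (φ v : ℂ)) ξ := by
    rw [SchwartzMap.fourier_coe, Real.fourier_eq', ft,
      ← (PiLp.volume_preserving_ofLp (Fin d)).integral_comp
      (MeasurableEquiv.toLp 2 (Fin d → ℝ)).symm.measurableEmbedding]
    refine integral_congr_ae (ae_of_all _ fun v => ?_)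
    change _ * (φ (WithLp.ofLp v) : ℂ) = _
    rw [mul_comm]
    refine congrArg (fun z => (φ (WithLp.ofLp v) : ℂ) * Complex.exp z) ?_
    simp [PiLp.inner_apply]
    ring
  rw [norm_iteratedFDeriv_zero, hval]
  refine mul_le_mul_of_nonneg_right (pow_le_pow_left₀ (norm_nonneg _) ?_ r) (norm_nonneg _)
  exact (pi_norm_le_iff_of_nonneg (norm_nonneg _)).2 fun i =>
    PiLp.norm_apply_le (WithLp.toLp 2 ξ) i

theorem summable_ft_smul_intCast {d : ℕ} {φ : (Fin d → ℝ) → ℝ}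
    (hφ_smooth : ContDiff ℝ (⊤ : ℕ∞) φ) (hφ_supp : HasCompactSupport φ) {ε : ℝ} (hε : 0 < ε) :
    Summable fun n : Fin d → ℤ =>
      ‖ft d (fun v => (φ v : ℂ)) (ε • fun i => (n i : ℝ))‖ := by
  obtain ⟨C, hC⟩ := exists_norm_pow_mul_norm_ft_le hφ_smooth hφ_supp (d + 1)
  refine Summable.of_norm_bounded_eventually
    ((summable_norm_intCast_inv_pow d d.lt_succ_self).mul_left (ε⁻¹ ^ (d + 1) * C)) ?_
  filter_upwards [(Set.finite_singleton (0 : Fin d → ℤ)).compl_mem_cofinite] with n hn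
  have hpos : 0 < ‖fun i => (n i : ℝ)‖ := by
    refine norm_pos_iff.2 fun h => hn ?_
    funext i
    exact Int.cast_eq_zero.1 (congrFun h i)
  have := hC (ε • fun i => (n i : ℝ))
  rw [norm_smul, Real.norm_of_nonneg hε.le] at this
  rw [norm_norm, mul_right_comm, ← mul_pow, ← mul_inv, inv_pow,
    le_inv_mul_iff₀ (by positivity)]
  exact this

theorem hasSum_fourier_of_periodic {d : ℕ} (f : (Fin d → ℝ) → ℂ) (hf : Continuous f)
    (hper : ∀ (u : Fin d → ℝ) (n : Fin d → ℤ), f (u + fun i => (n i : ℝ)) = f u)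
    (c : (Fin d → ℤ) → ℂ)
    (hc : ∀ m, c m = ∫ u in Set.univ.pi fun _ : Fin d => Set.Ioc (0 : ℝ) 1,
      Complex.exp (-(2 * π * Complex.I * ∑ k, (m k : ℂ) * u k)) * f u)
    (hs : Summable c) (x : Fin d → ℝ) :
    HasSum (fun m => c m * Complex.exp (2 * π * Complex.I * ∑ k, (m k : ℂ) * x k)) (f x) := by
  have hq : IsOpenQuotientMap (Pi.map fun _ : Fin d => ((↑) : ℝ → UnitAddCircle)) :=
    IsOpenQuotientMap.piMap fun _ => QuotientAddGroup.isOpenQuotientMap_mk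
  have hE : ∀ (m : Fin d → ℤ) (u : Fin d → ℝ),
      UnitAddTorus.mFourier m (fun i => (u i : UnitAddCircle)) =
        Complex.exp (2 * π * Complex.I * ∑ k, (m k : ℂ) * u k) := by
    intro m u
    simp only [UnitAddTorus.mFourier, ContinuousMap.coe_mk, fourier_coe_apply]
    rw [← Complex.exp_sum, Finset.mul_sum]
    congr 1
    refine Finset.sum_congr rfl fun k _ => ?_
    simp
    ring
  let p : C(Fin d → ℝ, UnitAddTorus (Fin d)) := ⟨_, hq.continuous⟩
  have hp : Topology.IsQuotientMap p := hq.isQuotientMap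
  have hfac : Function.FactorsThrough f p := by
    intro a b hab
    have : ∀ i, ∃ n : ℤ, a i = b i + n := by
      intro i
      have h := congrFun hab i
      obtain ⟨n, hn⟩ := (QuotientAddGroup.eq_iff_sub_mem.1 h)
      refine ⟨n, ?_⟩
      simp at hn
      linarith
    choose n hn using this
    rw [show a = b + fun i => (n i : ℝ) from funext hn]
    exact hper b n
  let g : C(UnitAddTorus (Fin d), ℂ) := hp.lift ⟨f, hf⟩ hfac
  have hg : ∀ u : Fin d → ℝ, g (fun i => (u i : UnitAddCircle)) = f u := fun u =>
    DFunLike.congr_fun (hp.lift_comp ⟨f, hf⟩ hfac) u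
  have hcoef : UnitAddTorus.mFourierCoeff g = c := by
    funext m
    rw [UnitAddTorus.mFourierCoeff_eq_integral _ _ 0, hc]
    simp only [hg, hE, smul_eq_mul]
    have : {x : Fin d → ℝ | ∀ i, x i ∈ Set.Ioc ((0 : Fin d → ℝ) i) ((0 : Fin d → ℝ) i + 1)} =
      Set.univ.pi fun _ : Fin d => Set.Ioc (0 : ℝ) 1 := by ext; simp
    rw [this]
    congr with u
    simp
  have := UnitAddTorus.hasSum_mFourier_series_apply_of_summable (f := g) (by rwa [hcoef])
    (fun i => (x i : UnitAddCircle))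
  rw [hg] at this
  simpa only [hcoef, hE, smul_eq_mul] using this

theorem ae_fract_sub_mulVec_ne_zero {d : ℕ} {A : Matrix (Fin d) (Fin d) ℝ} (hA : A.det ≠ 0)
    (u : Fin d → ℝ) : ∀ᵐ v : Fin d → ℝ, ∀ k, Int.fract ((u - A.mulVec v) k) ≠ 0 := by
  have hA' : Measure.QuasiMeasurePreserving (fun v : Fin d → ℝ => A.mulVec v) := by
    refine ⟨by fun_prop, ?_⟩
    have h := Real.map_matrix_volume_pi_eq_smul_volume_pi hA
    rw [show (fun v : Fin d → ℝ => A.mulVec v) = Matrix.toLin' A from rfl, h]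
    exact Measure.smul_absolutelyContinuous
  refine ae_all_iff.2 fun k => ?_
  have h1 : ∀ᵐ s : ℝ, Int.fract (u k - s) ≠ 0 := by
    have hc : (Set.range fun n : ℤ => u k - n).Countable := Set.countable_range _
    filter_upwards [hc.ae_notMem volume] with s hs h0
    refine hs ⟨⌊u k - s⌋, ?_⟩
    have := Int.floor_add_fract (u k - s)
    simp only
    linarith
  exact hA'.ae ((Measure.quasiMeasurePreserving_eval (μ := fun _ : Fin d => (volume : Measure ℝ))
    k).ae h1)

/-- The product `∏ₖ B_{Jₖ}(uₖ)` of periodized Bernoulli polynomials on `ℝ^d`. -/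
noncomputable def perBProd {d : ℕ} (J : Fin d → ℕ) (u : Fin d → ℝ) : ℝ := ∏ k, perB (J k) (u k)

theorem measurable_perBProd {d : ℕ} (J : Fin d → ℕ) : Measurable (perBProd J) :=
  Finset.measurable_prod _ fun k _ => (measurable_perB (J k)).comp (measurable_pi_apply k)

theorem exists_abs_perBProd_le {d : ℕ} (J : Fin d → ℕ) : ∃ C, ∀ u, |perBProd J u| ≤ C := by
  choose C hC0 hC using fun k => exists_abs_perB_le (J k)
  refine ⟨∏ k, C k, fun u => ?_⟩
  rw [perBProd, Finset.abs_prod]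
  exact Finset.prod_le_prod (fun _ _ => abs_nonneg _) fun k _ => hC k _

theorem perBProd_add_intCast {d : ℕ} (J : Fin d → ℕ) (u : Fin d → ℝ) (n : Fin d → ℤ) :
    perBProd J (u + fun i => (n i : ℝ)) = perBProd J u :=
  Finset.prod_congr rfl fun _ _ => perB_add_intCast _ _ _

theorem continuous_integral_mul_perBProd {d : ℕ} (J : Fin d → ℕ) {φ : (Fin d → ℝ) → ℝ}
    (hφ : Integrable φ) {A : Matrix (Fin d) (Fin d) ℝ} (hA : A.det ≠ 0) :
    Continuous fun u => ∫ v, (φ v : ℂ) * (perBProd J (u - A.mulVec v) : ℂ) := by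
  obtain ⟨C, hC⟩ := exists_abs_perBProd_le J
  have hmeas : ∀ u : Fin d → ℝ, Measurable fun v => (perBProd J (u - A.mulVec v) : ℂ) := fun u =>
    Complex.measurable_ofReal.comp ((measurable_perBProd J).comp (by fun_prop))
  refine continuous_iff_continuousAt.2 fun u => ?_
  refine continuousAt_of_dominated (bound := fun v => |φ v| * C) ?_ ?_ ?_ ?_
  · exact .of_forall fun u => hφ.ofReal.aestronglyMeasurable.mul (hmeas u).aestronglyMeasurable
  · refine .of_forall fun u => ae_of_all _ fun v => ?_
    rw [norm_mul, Complex.norm_real, Complex.norm_real]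
    exact mul_le_mul_of_nonneg_left (hC _) (norm_nonneg _)
  · exact hφ.abs.mul_const C
  · filter_upwards [ae_fract_sub_mulVec_ne_zero hA u] with v hv
    refine continuousAt_const.mul (Complex.continuous_ofReal.continuousAt.comp ?_)
    refine tendsto_finsetProd _ fun k _ => ?_
    exact (continuousAt_perB (J k) (hv k)).tendsto.comp
      (Continuous.tendsto (f := fun u : Fin d → ℝ => (u - A.mulVec v) k) (by fun_prop) u)

/-- The Fourier coefficient of index `m` of the periodized Bernoulli polynomial of degree `j`. -/
noncomputable def perBCoeff (j : ℕ) (m : ℤ) : ℂ :=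
  if j = 0 then (if m = 0 then 1 else 0) else -(1 / (2 * π * Complex.I * m) ^ j)

theorem norm_perBCoeff_le_one (j : ℕ) (m : ℤ) : ‖perBCoeff j m‖ ≤ 1 := by
  unfold perBCoeff
  split_ifs with hj hm
  · simp
  · simp
  · rw [norm_neg, norm_div, norm_one, norm_pow]
    rcases eq_or_ne m 0 with rfl | hm
    · simp [hj]
    · have h1 : (1 : ℝ) ≤ ‖2 * π * Complex.I * (m : ℂ)‖ := by
        have hm1 : (1 : ℝ) ≤ |(m : ℝ)| := by exact_mod_cast Int.one_le_abs hm
        simp only [norm_mul, Complex.norm_I, Complex.norm_real, Complex.norm_intCast,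
          Complex.norm_ofNat, mul_one, Real.norm_eq_abs, abs_of_pos Real.pi_pos]
        nlinarith [Real.pi_gt_three]
      exact div_le_one_of_le₀ (one_le_pow₀ h1) (by positivity)

theorem setIntegral_exp_mul_perBProd_sub {d : ℕ} (J : Fin d → ℕ) (m : Fin d → ℤ)
    (w : Fin d → ℝ) :
    ∫ u in Set.univ.pi fun _ : Fin d => Set.Ioc (0 : ℝ) 1,
      Complex.exp (-(2 * π * Complex.I * ∑ k, (m k : ℂ) * u k)) * (perBProd J (u - w) : ℂ) =
    Complex.exp (-(2 * π * Complex.I * ∑ k, (m k : ℂ) * w k)) * ∏ k, perBCoeff (J k) (m k) := by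
  have hexp : ∀ u : Fin d → ℝ, Complex.exp (-(2 * π * Complex.I * ∑ k, (m k : ℂ) * u k)) =
      ∏ k, Complex.exp (-(2 * π * Complex.I * (m k * u k))) := by
    intro u
    rw [← Complex.exp_sum, Finset.sum_neg_distrib, Finset.mul_sum]
  rw [volume_pi, Measure.restrict_pi_pi]
  simp only [hexp, perBProd, Complex.ofReal_prod, ← Finset.prod_mul_distrib, Pi.sub_apply]
  rw [integral_fintype_prod_eq_prod fun k (t : ℝ) =>
    Complex.exp (-(2 * π * Complex.I * (m k * t))) * (perB (J k) (t - w k) : ℂ)]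
  refine Finset.prod_congr rfl fun k _ => ?_
  rw [← intervalIntegral.integral_of_le zero_le_one, integral_exp_mul_perB_sub,
    integral_exp_mul_perB]
  rfl

theorem setIntegral_exp_mul_integral_mul_perBProd {d : ℕ} (J : Fin d → ℕ) {φ : (Fin d → ℝ) → ℝ}
    (hφ : Integrable φ) (A : Matrix (Fin d) (Fin d) ℝ) (m : Fin d → ℤ) :
    ∫ u in Set.univ.pi fun _ : Fin d => Set.Ioc (0 : ℝ) 1,
      Complex.exp (-(2 * π * Complex.I * ∑ k, (m k : ℂ) * u k)) *
        ∫ v, (φ v : ℂ) * (perBProd J (u - A.mulVec v) : ℂ) =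
    ft d (fun v => (φ v : ℂ)) (A.transpose.mulVec fun k => (m k : ℝ)) *
      ∏ k, perBCoeff (J k) (m k) := by
  obtain ⟨C, hC⟩ := exists_abs_perBProd_le J
  set box := Set.univ.pi fun _ : Fin d => Set.Ioc (0 : ℝ) 1
  have : IsFiniteMeasure (volume.restrict box) := by
    refine ⟨?_⟩
    rw [Measure.restrict_apply_univ, volume_pi_pi]
    simp
  have hint : Integrable (fun p : (Fin d → ℝ) × (Fin d → ℝ) =>
      Complex.exp (-(2 * π * Complex.I * ∑ k, (m k : ℂ) * p.1 k)) *
        ((φ p.2 : ℂ) * (perBProd J (p.1 - A.mulVec p.2) : ℂ)))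
      ((volume.restrict box).prod volume) := by
    have hφ2 : Integrable (fun p : (Fin d → ℝ) × (Fin d → ℝ) => (φ p.2 : ℂ))
        ((volume.restrict box).prod volume) :=
      Integrable.comp_snd (f := fun v => (φ v : ℂ)) hφ.ofReal _
    have hm : Measurable fun p : (Fin d → ℝ) × (Fin d → ℝ) =>
        (perBProd J (p.1 - A.mulVec p.2) : ℂ) :=
      Complex.measurable_ofReal.comp ((measurable_perBProd J).comp (by fun_prop))
    refine Integrable.bdd_mul (c := 1) (hφ2.mul_bdd (c := C) hm.aestronglyMeasurable ?_) ?_ ?_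
    · exact ae_of_all _ fun p => by simpa using hC _
    · exact Continuous.aestronglyMeasurable (by fun_prop)
    · refine ae_of_all _ fun p => ?_
      rw [show -(2 * π * Complex.I * ∑ k, (m k : ℂ) * p.1 k) =
        ((-(2 * π * ∑ k, (m k : ℝ) * p.1 k) : ℝ) : ℂ) * Complex.I by push_cast; ring]
      exact (Complex.norm_exp_ofReal_mul_I _).le
  simp only [← integral_const_mul]
  rw [integral_integral_swap hint, ft, ← integral_mul_const]
  refine integral_congr_ae (ae_of_all _ fun v => ?_)
  have hcomm : ∀ a b : ℂ, a * ((φ v : ℂ) * b) = φ v * (a * b) := fun a b => by ring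
  simp only [hcomm, integral_const_mul]
  rw [setIntegral_exp_mul_perBProd_sub, ← mul_assoc (φ v : ℂ)]
  congr 3
  have hdot : ∑ k, (m k : ℝ) * A.mulVec v k =
      ∑ i, (A.transpose.mulVec fun k => (m k : ℝ)) i * v i := by
    rw [Matrix.mulVec_transpose]
    exact Matrix.dotProduct_mulVec (fun k => (m k : ℝ)) A v
  rw [← hdot]
  push_cast
  ring

theorem prod_perBCoeff {d : ℕ} (J : Fin d → ℕ) (m : Fin d → ℤ) :
    ∏ k, perBCoeff (J k) (m k) =
      if ∀ k, (m k = 0 ↔ J k = 0) then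
        (-1) ^ (Finset.univ.filter fun k => J k ≠ 0).card /
          ∏ k, (2 * π * Complex.I * (m k : ℂ)) ^ J k
      else 0 := by
  split_ifs with h
  · rw [Finset.card_filter, ← Finset.prod_pow_eq_pow_sum, ← Finset.prod_div_distrib]
    refine Finset.prod_congr rfl fun k _ => ?_
    by_cases hk : J k = 0
    · simp [perBCoeff, hk, (h k).2 hk]
    · simp [perBCoeff, hk, neg_div]
  · push Not at h
    obtain ⟨k, hk⟩ := h
    refine Finset.prod_eq_zero (Finset.mem_univ k) ?_
    rcases hk with ⟨h1, h2⟩ | ⟨h1, h2⟩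
    · simp [perBCoeff, h1, h2]
    · simp [perBCoeff, h1, h2]

theorem hasSum_ft_mul_perBCoeff {d : ℕ} (J : Fin d → ℕ) {φ : (Fin d → ℝ) → ℝ}
    (hφ : Integrable φ) {A : Matrix (Fin d) (Fin d) ℝ} (hA : A.det ≠ 0)
    (hs : Summable fun m : Fin d → ℤ =>
      ‖ft d (fun v => (φ v : ℂ)) (A.transpose.mulVec fun k => (m k : ℝ))‖) (y : Fin d → ℝ) :
    HasSum (fun m : Fin d → ℤ =>
      ft d (fun v => (φ v : ℂ)) (A.transpose.mulVec fun k => (m k : ℝ)) *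
        (∏ k, perBCoeff (J k) (m k)) * Complex.exp (2 * π * Complex.I * ∑ k, (m k : ℂ) * y k))
      (∫ v, (φ v : ℂ) * (perBProd J (y - A.mulVec v) : ℂ)) := by
  refine hasSum_fourier_of_periodic
    (fun u => ∫ v, (φ v : ℂ) * (perBProd J (u - A.mulVec v) : ℂ))
    (continuous_integral_mul_perBProd J hφ hA) (fun u n => ?_) _
    (fun m => (setIntegral_exp_mul_integral_mul_perBProd J hφ A m).symm) ?_ y
  · simp only [add_sub_right_comm u, perBProd_add_intCast]
  · refine Summable.of_norm_bounded hs fun m => ?_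
    rw [norm_mul, norm_prod]
    exact mul_le_of_le_one_right (norm_nonneg _)
      (Finset.prod_le_one (fun k _ => norm_nonneg _) fun k _ => norm_perBCoeff_le_one _ _)

theorem periB_sub_smul_eq_perBProd {d : ℕ} (J : Fin d → ℕ) {L : Matrix (Fin d) (Fin d) ℤ}
    (hL : IsUnit L.det) (x v : Fin d → ℝ) (ε : ℝ) :
    periB d J (L.map (Int.cast : ℤ → ℝ)) (x - ε • v) =
      perBProd J ((L⁻¹.transpose.map (Int.cast : ℤ → ℝ)).mulVec x -
        (ε • L⁻¹.transpose.map (Int.cast : ℤ → ℝ)).mulVec v) := by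
  rw [periB_eq_prod J hL, Matrix.mulVec_sub, Matrix.mulVec_smul, Matrix.smul_mulVec]
  rfl

/-- Summing the mollified Fourier series of `𝔅_{J,L}` gives the convolution of its
unregularized version with the mollifier. -/
theorem mollified_fourier_series_eq {d : ℕ} {φ : (Fin d → ℝ) → ℝ}
    (hφ_smooth : ContDiff ℝ (⊤ : ℕ∞) φ) (hφ_supp : HasCompactSupport φ)
    (J : Fin d → ℕ) {L : Matrix (Fin d) (Fin d) ℤ} (hL : IsUnit L.det)
    (x : Fin d → ℝ) {ε : ℝ} (hε : 0 < ε) :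
    (-1 : ℂ) ^ (Finset.univ.filter fun k => J k ≠ 0).card *
      ∑' n : Fin d → ℤ,
        (if ∀ k, (L.mulVec n k = 0 ↔ J k = 0) then
          ft d (fun v => ((φ v : ℝ) : ℂ)) (ε • fun i => (n i : ℝ)) *
            Complex.exp (2 * π * Complex.I * (∑ i, (n i : ℝ) * x i)) /
            ∏ k, (2 * π * Complex.I * ((L.mulVec n k : ℤ) : ℂ)) ^ (J k)
        else 0) =
    ((∫ v, φ v * periB d J (L.map (Int.cast : ℤ → ℝ)) (x - ε • v) : ℝ) : ℂ) := by
  have hφ : Integrable φ := hφ_smooth.continuous.integrable_of_hasCompactSupport hφ_supp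
  set M : Matrix (Fin d) (Fin d) ℝ := L⁻¹.transpose.map (Int.cast : ℤ → ℝ)
  have hM : M.transpose * L.map (Int.cast : ℤ → ℝ) = 1 := by
    have h := congrArg (fun A => A.map (Int.castRingHom ℝ)) (Matrix.nonsing_inv_mul L hL)
    rw [Matrix.map_mul] at h
    simpa [M, Matrix.transpose_map] using h
  have hcast : ∀ n : Fin d → ℤ, (fun k => ((L.mulVec n k : ℤ) : ℝ)) =
      (L.map (Int.cast : ℤ → ℝ)).mulVec fun i => (n i : ℝ) := fun n =>
    (map_intCast_mulVec L n).symm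
  have hdet : (ε • M).det ≠ 0 := by
    rw [Matrix.det_smul]
    refine mul_ne_zero (pow_ne_zero _ hε.ne') fun h0 => ?_
    have h := congrArg Matrix.det hM
    rw [Matrix.det_mul, Matrix.det_transpose, h0, zero_mul, Matrix.det_one] at h
    exact zero_ne_one h
  have hfreq : ∀ n : Fin d → ℤ, (ε • M).transpose.mulVec (fun k => ((L.mulVec n k : ℤ) : ℝ)) =
      ε • fun i => (n i : ℝ) := by
    intro n
    rw [hcast, Matrix.transpose_smul, Matrix.smul_mulVec, Matrix.mulVec_mulVec, hM,
      Matrix.one_mulVec]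
  have hdot : ∀ n : Fin d → ℤ, ∑ k, ((L.mulVec n k : ℤ) : ℝ) * M.mulVec x k =
      ∑ i, (n i : ℝ) * x i := by
    intro n
    have h := Matrix.dotProduct_mulVec (fun k => ((L.mulVec n k : ℤ) : ℝ)) M x
    rw [← Matrix.mulVec_transpose, hcast, Matrix.mulVec_mulVec, hM, Matrix.one_mulVec] at h
    rw [← hcast] at h
    exact h
  have hs : Summable fun m : Fin d → ℤ =>
      ‖ft d (fun v => (φ v : ℂ)) ((ε • M).transpose.mulVec fun k => (m k : ℝ))‖ := by
    rw [← (unimodularEquiv L hL).summable_iff]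
    simpa only [Function.comp_def, unimodularEquiv_apply, hfreq] using
      summable_ft_smul_intCast hφ_smooth hφ_supp hε
  have hsum := (unimodularEquiv L hL).hasSum_iff.2
    (hasSum_ft_mul_perBCoeff J hφ hdet hs (M.mulVec x))
  have hint : ((∫ v, φ v * periB d J (L.map (Int.cast : ℤ → ℝ)) (x - ε • v) : ℝ) : ℂ) =
      ∫ v, (φ v : ℂ) * (perBProd J (M.mulVec x - (ε • M).mulVec v) : ℂ) := by
    rw [← integral_complex_ofReal]
    refine integral_congr_ae (ae_of_all _ fun v => ?_)
    simp only [Complex.ofReal_mul, periB_sub_smul_eq_perBProd J hL, M]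
  rw [hint, ← hsum.tsum_eq, ← tsum_mul_left]
  refine tsum_congr fun n => ?_
  rw [Function.comp_apply, unimodularEquiv_apply, hfreq, prod_perBCoeff]
  split_ifs
  · have hexp : ∑ k, ((L.mulVec n k : ℤ) : ℂ) * (M.mulVec x k : ℂ) =
        ((∑ i, (n i : ℝ) * x i : ℝ) : ℂ) := by
      rw [← hdot n]
      push_cast
      rfl
    rw [hexp]
    ring
  · simp

theorem stmt12 (d : ℕ) (hd : 1 ≤ d)
    (φ : (Fin d → ℝ) → ℝ) (hφ_smooth : ContDiff ℝ (⊤ : ℕ∞) φ) (hφ_nonneg : ∀ x, 0 ≤ φ x)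
    (hφ_radial : ∀ x y : Fin d → ℝ, ∑ i, (x i) ^ 2 = ∑ i, (y i) ^ 2 → φ x = φ y)
    (hφ_supp : HasCompactSupport φ) (hφ_int : ∫ x, φ x = 1)
    (J : Fin d → ℕ) (L : Matrix (Fin d) (Fin d) ℤ) (hL : IsUnit L.det)
    (x : Fin d → ℝ) :
    Tendsto (fun ε : ℝ =>
        (-1 : ℂ) ^ (Finset.univ.filter fun k => J k ≠ 0).card *
          ∑' n : Fin d → ℤ,
            (if ∀ k, (L.mulVec n k = 0 ↔ J k = 0) then
              ft d (fun v => ((φ v : ℝ) : ℂ)) (ε • fun i => (n i : ℝ)) *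
                Complex.exp (2 * π * Complex.I * (∑ i, (n i : ℝ) * x i)) /
                ∏ k, (2 * π * Complex.I * ((L.mulVec n k : ℤ) : ℂ)) ^ (J k)
            else 0))
      (𝓝[>] 0)
      (𝓝 ((frakB d J (L.map (Int.cast : ℤ → ℝ)) x : ℝ) : ℂ)) := by
  have hφ : Integrable φ := hφ_smooth.continuous.integrable_of_hasCompactSupport hφ_supp
  set Lr : Matrix (Fin d) (Fin d) ℝ := L.map (Int.cast : ℤ → ℝ)
  have hF : ∀ v, periB d J Lr (x - v) =
      perBProd J ((L⁻¹.transpose.map (Int.cast : ℤ → ℝ)).mulVec x -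
        (L⁻¹.transpose.map (Int.cast : ℤ → ℝ)).mulVec v) := by
    intro v
    simpa only [one_smul] using periB_sub_smul_eq_perBProd J hL x v 1
  obtain ⟨C, hC⟩ := exists_abs_perBProd_le J
  obtain ⟨l, hball, hconv⟩ := tendsto_radial_average hd hφ_radial hφ hφ_int
    (F := fun v => periB d J Lr (x - v))
    (by
      simp only [hF]
      exact (measurable_perBProd J).comp (by fun_prop))
    (C := C) (fun v => by rw [hF]; exact hC _)
    (by
      intro v
      choose l hl using fun k => exists_tendsto_perB_ray (J k)
        ((L⁻¹.transpose.map (Int.cast : ℤ → ℝ)).mulVec x k)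
        ((L⁻¹.transpose.map (Int.cast : ℤ → ℝ)).mulVec v k)
      refine ⟨∏ k, l k, ?_⟩
      simp only [hF, perBProd, Matrix.mulVec_smul, Pi.sub_apply, Pi.smul_apply, smul_eq_mul]
      exact tendsto_finsetProd _ fun k _ => hl k)
  rw [show frakB d J Lr x = l from hball.limUnder_eq]
  refine ((Complex.continuous_ofReal.tendsto l).comp hconv).congr' ?_
  filter_upwards [self_mem_nhdsWithin] with ε hε
  exact (mollified_fourier_series_eq hφ_smooth hφ_supp J hL x hε).symm
end
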